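/- arXiv:1412.4706 — 2 statements merged into one kernel-verified Lean document; each statement's English description precedes it below -/
import Mathlib

section
/- Let N ≥ 2 be an integer, v ∈ ℝ^N, and let F : ℝ^N × S^{N−1} → [0,∞] be measurable. For v' ∈ ℝ^N with v' ≠ v and w in the hyperplane {w ∈ ℝ^N : w·(v'−v) = 0}, set r = √(|v'−v|² + |w|²), and note that σ := ((v'−v) − w)/r is a unit vector. Then ∫_{ℝ^N} ∫_{S^{N−1}} F(v_*, σ) dσ dv_* = 2^{N−1} ∫_{ℝ^N} (1/|v'−v|) ∫_{{w : w·(v'−v) = 0}} F(v'+w, ((v'−v)−w)/r) r^{−(N−2)} dS(w) dv', where dσ is the surface measure on S^{N−1} and dS is the (N−1)-dimensional Hausdorff measure on the hyperplane {w : w·(v'−v) = 0}, both sides being possibly infinite. -/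
open MeasureTheory Metric Set
open scoped ENNReal RealInnerProductSpace

noncomputable section

section CollisionGeometry

open Module Measure
open scoped NNReal Topology

lemma exists_hausdorffMeasure_eq_smul_euclideanHausdorffMeasure (X : Type*) [EMetricSpace X]
    [MeasurableSpace X] [BorelSpace X] (n : ℕ) :
    ∃ c : ℝ≥0, (μH[n] : Measure X) = c • μHE[n] := by
  refine ⟨_, (inv_smul_smul₀ (addHaarScalarFactor_volume_hausdorffMeasure_ne_zero n) _).symm⟩

section Lipschitz

variable {X Y : Type*} [MetricSpace X] [MeasurableSpace X] [BorelSpace X] [MetricSpace Y]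
  [MeasurableSpace Y] [BorelSpace Y] {f : X → Y} {s : Set X} {K : ℝ≥0}

lemma LipschitzOnWith.euclideanHausdorffMeasure_image_le (hf : LipschitzOnWith K f s) (d : ℕ) :
    μHE[d] (f '' s) ≤ K ^ d * μHE[d] s := by
  have h := hf.hausdorffMeasure_image_le (d := d) (Nat.cast_nonneg d)
  rw [ENNReal.rpow_natCast] at h
  simp only [euclideanHausdorffMeasure_def, Measure.smul_apply, ENNReal.smul_def, smul_eq_mul]
  calc _ ≤ _ := mul_le_mul_right h _
    _ = _ := by ring

lemma euclideanHausdorffMeasure_le_image_of_dist_le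
    (hf : ∀ x ∈ s, ∀ y ∈ s, dist x y ≤ K * dist (f x) (f y)) (d : ℕ) :
    μHE[d] s ≤ K ^ d * μHE[d] (f '' s) := by
  have ha : AntilipschitzWith K (fun x : s => f x) :=
    AntilipschitzWith.of_le_mul_dist fun x y => hf x x.2 y y.2
  have h := ha.le_hausdorffMeasure_image (d := d) (Nat.cast_nonneg d) univ
  rw [ENNReal.rpow_natCast, image_univ, ← isometry_subtype_coe.hausdorffMeasure_image (by simp),
    image_univ, Subtype.range_coe, ← image_eq_range] at h
  simp only [euclideanHausdorffMeasure_def, Measure.smul_apply, ENNReal.smul_def, smul_eq_mul]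
  calc _ ≤ _ := mul_le_mul_right h _
    _ = _ := by ring

end Lipschitz

lemma measure_le_mul_of_forall_exists_nhds {X : Type*} [TopologicalSpace X]
    [SecondCountableTopology X] [MeasurableSpace X] [OpensMeasurableSpace X] {μ ν : Measure X}
    {C : ℝ≥0∞} (h : ∀ x, ∃ V ∈ 𝓝 x, ∀ A ⊆ V, MeasurableSet A → μ A ≤ C * ν A) {A : Set X}
    (hA : MeasurableSet A) : μ A ≤ C * ν A := by
  choose V hV hμν using h
  rcases isEmpty_or_nonempty X with hX | hX
  · simp [Set.eq_empty_of_isEmpty A]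
  obtain ⟨s, hs, hsU⟩ := TopologicalSpace.countable_cover_nhds
    (fun x => interior_mem_nhds.2 (hV x))
  have hne : s.Nonempty := by
    by_contra hne
    rw [not_nonempty_iff_eq_empty] at hne
    rw [hne, biUnion_empty] at hsU
    exact empty_ne_univ hsU
  obtain ⟨f, rfl⟩ := hs.exists_eq_range hne
  rw [biUnion_range] at hsU
  set D := disjointed fun k => interior (V (f k)) with hD
  have hDm (k : ℕ) : MeasurableSet (A ∩ D k) :=
    hA.inter (MeasurableSet.disjointed (fun _ => isOpen_interior.measurableSet) k)
  have hDd : Pairwise (Function.onFun Disjoint fun k => A ∩ D k) := fun i j hij =>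
    (disjoint_disjointed _ hij).mono inter_subset_right inter_subset_right
  have hAD : A = ⋃ k, A ∩ D k := by
    rw [← inter_iUnion, hD, iUnion_disjointed, hsU, inter_univ]
  rw [hAD, measure_iUnion hDd hDm, measure_iUnion hDd hDm, ← ENNReal.tsum_mul_left]
  exact ENNReal.tsum_le_tsum fun k => hμν (f k) _
    (inter_subset_right.trans ((disjointed_subset _ k).trans interior_subset)) (hDm k)

variable {E : Type*} [NormedAddCommGroup E] [InnerProductSpace ℝ E]

/-- The spherical map `ω ↦ 2 ⟪e, ω⟫ ω - e`, extended to `E` as a quadratic map. -/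
def sphericalSquare (e x : E) : E := (2 * ⟪e, x⟫) • x - ‖x‖ ^ 2 • e

/-- The derivative of `sphericalSquare e`. -/
def sphericalSquareDeriv (e x : E) : E →L[ℝ] E :=
  (2 * ⟪e, x⟫) • ContinuousLinearMap.id ℝ E + (2 • innerSL ℝ e).smulRight x -
    (2 • innerSL ℝ x).smulRight e

lemma hasFDerivAt_sphericalSquare (e x : E) :
    HasFDerivAt (sphericalSquare e) (sphericalSquareDeriv e x) x := by
  have h1 : HasFDerivAt (fun y : E => 2 * ⟪e, y⟫) (2 • innerSL ℝ e) x := by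
    have := ((innerSL ℝ e).hasFDerivAt (x := x)).const_mul 2
    convert! this using 1
    ext; simp
  have h2 : HasFDerivAt (fun y : E => ‖y‖ ^ 2) (2 • innerSL ℝ x) x :=
    (hasStrictFDerivAt_norm_sq x).hasFDerivAt
  have h3 := (h1.smul (hasFDerivAt_id x)).sub (h2.smul_const e)
  exact h3

lemma det_sphericalSquareDeriv [FiniteDimensional ℝ E] {m : ℕ}
    (hn : finrank ℝ E = m + 2) {e x : E} (he : ‖e‖ = 1)
    (hx : ⟪e, x⟫ ≠ 0) :
    (sphericalSquareDeriv e x).det = 2 ^ (m + 2) * ⟪e, x⟫ ^ m * ‖x‖ ^ 2 := by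
  set a := ⟪e, x⟫ with ha
  let b := stdOrthonormalBasis ℝ E
  let U : Matrix (Fin (finrank ℝ E)) (Fin 2) ℝ := .of fun i => ![a⁻¹ * ⟪b i, x⟫, a⁻¹ * ⟪b i, e⟫]
  let V : Matrix (Fin 2) (Fin (finrank ℝ E)) ℝ := .of ![fun j => ⟪e, b j⟫, fun j => -⟪x, b j⟫]
  have hM : LinearMap.toMatrix b.toBasis b.toBasis (sphericalSquareDeriv e x : E →ₗ[ℝ] E) =
      (2 * a) • (1 + U * V) := by
    ext i j
    simp [LinearMap.toMatrix_apply, sphericalSquareDeriv, U, V, Matrix.mul_apply, Fin.sum_univ_two,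
      Matrix.one_apply, ← ha]
    simp only [OrthonormalBasis.repr_apply_apply]
    split_ifs <;> field_simp <;> ring
  have hVU : (1 + V * U).det = ‖x‖ ^ 2 / a ^ 2 := by
    have key (y z : E) : ∑ j, ⟪y, b j⟫ * ⟪b j, z⟫ = ⟪y, z⟫ := b.sum_inner_mul_inner y z
    have key' (y z : E) : ∑ j, ⟪y, b j⟫ * (a⁻¹ * ⟪b j, z⟫) = a⁻¹ * ⟪y, z⟫ := by
      rw [← key, Finset.mul_sum]; exact Finset.sum_congr rfl fun _ _ => by ring
    have hUV (k l : Fin 2) : (V * U) k l = ∑ j, V k j * U j l := Matrix.mul_apply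
    rw [Matrix.det_fin_two]
    simp only [Matrix.add_apply, hUV]
    simp [U, V, key', he, real_inner_comm e x, ← ha, hx]
    field_simp
  rw [ContinuousLinearMap.det, ← LinearMap.det_toMatrix b.toBasis, hM, Matrix.det_smul,
    Matrix.det_one_add_mul_comm, hVU, Fintype.card_fin, hn]
  field_simp
  ring

lemma norm_sphericalSquare {e : E} (he : ‖e‖ = 1) (x : E) : ‖sphericalSquare e x‖ = ‖x‖ ^ 2 := by
  rw [← sq_eq_sq₀ (norm_nonneg _) (by positivity), sphericalSquare, norm_sub_sq_real]
  simp only [norm_smul, inner_smul_left, inner_smul_right, he, real_inner_comm e x]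
  simp [mul_pow]
  ring

lemma inner_sphericalSquare {e : E} (he : ‖e‖ = 1) (x : E) :
    ⟪e, sphericalSquare e x⟫ = 2 * ⟪e, x⟫ ^ 2 - ‖x‖ ^ 2 := by
  simp [sphericalSquare, inner_sub_right, inner_smul_right, he]
  ring

lemma injOn_sphericalSquare {e : E} (he : ‖e‖ = 1) :
    InjOn (sphericalSquare e) {x | 0 < ⟪e, x⟫} := by
  intro x hx y hy hxy
  have h1 : ‖x‖ ^ 2 = ‖y‖ ^ 2 := by rw [← norm_sphericalSquare he, hxy, norm_sphericalSquare he]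
  have h2 : ⟪e, x⟫ = ⟪e, y⟫ := by
    have := inner_sphericalSquare he x
    rw [hxy, inner_sphericalSquare he] at this
    exact ((sq_eq_sq₀ (le_of_lt hx) (le_of_lt hy)).1 (by linarith))
  simp only [sphericalSquare, h1, h2, sub_left_inj] at hxy
  exact smul_right_injective E (mul_pos two_pos hy).ne' hxy

lemma compl_image_sphericalSquare_subset {e : E} (he : ‖e‖ = 1) :
    (sphericalSquare e '' {x | 0 < ⟪e, x⟫})ᶜ ⊆ (ℝ ∙ e : Submodule ℝ E) := by
  intro z hz
  by_contra hze
  apply hz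
  have hpos : 0 < ‖z‖ + ⟪e, z⟫ := by
    have h1 := neg_le_of_abs_le (abs_real_inner_le_norm e z)
    rw [he, one_mul] at h1
    rcases h1.lt_or_eq with h | h
    · linarith
    · exfalso
      have : ‖z + ‖z‖ • e‖ ^ 2 = 0 := by
        rw [norm_add_sq_real, inner_smul_right, real_inner_comm, ← h, norm_smul, he]
        simp
        ring
      have h0 : z + ‖z‖ • e = 0 := by simpa using this
      exact hze (Submodule.mem_span_singleton.2 ⟨-‖z‖, by
        rw [neg_smul, ← eq_neg_of_add_eq_zero_left h0]⟩)
  set s := ‖z‖ + ⟪e, z⟫ with hs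
  have hsq : √(2 * s) ^ 2 = 2 * s := Real.sq_sqrt (by positivity)
  have hsq0 : √(2 * s) ≠ 0 := (Real.sqrt_pos.2 (by positivity)).ne'
  have hin : ⟪e, (√(2 * s))⁻¹ • (z + ‖z‖ • e)⟫ = (√(2 * s))⁻¹ * s := by
    simp only [inner_smul_right, inner_add_right, real_inner_self_eq_norm_sq, he, hs]
    ring
  have hno : ‖(√(2 * s))⁻¹ • (z + ‖z‖ • e)‖ ^ 2 = ‖z‖ := by
    rw [norm_smul, mul_pow, norm_add_sq_real, inner_smul_right, real_inner_comm, norm_smul, he]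
    simp only [norm_inv, Real.norm_eq_abs, sq_abs, inv_pow, hsq, abs_norm]
    field_simp
    rw [hs]
    ring
  refine ⟨(√(2 * s))⁻¹ • (z + ‖z‖ • e), ?_, ?_⟩
  · simp only [mem_ofPred_eq, hin]
    positivity
  · rw [sphericalSquare, hin, hno, smul_smul]
    have : 2 * ((√(2 * s))⁻¹ * s) * (√(2 * s))⁻¹ = 1 := by
      field_simp
      linarith
    rw [this, one_smul]
    simp

/-- A map straightening the unit sphere near its point `e`: it sends a point `r • ω` with
`ω` in the sphere to `r • e` plus the orthogonal projection of `ω` on the complement of `e`. -/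
def straightenSphere (e x : E) : E := ‖x‖ • e + ‖x‖⁻¹ • (x - ⟪e, x⟫ • e)

lemma hasStrictFDerivAt_straightenSphere {e : E} (he : ‖e‖ = 1) :
    HasStrictFDerivAt (straightenSphere e) (ContinuousLinearMap.id ℝ E) e := by
  have h1 : HasStrictFDerivAt (fun x : E => ‖x‖) (innerSL ℝ e) e := by
    have := (hasStrictFDerivAt_norm_sq e).sqrt (by simp [he])
    simp only [Real.sqrt_sq (norm_nonneg _), he] at this
    convert! this using 1
    ext; simp
  have h2 : HasStrictFDerivAt (fun x : E => ‖x‖⁻¹) (-innerSL ℝ e) e := by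
    have := (hasStrictDerivAt_inv (x := ‖e‖) (by simp [he])).comp_hasStrictFDerivAt e h1
    convert! this using 1
    ext; simp [he]
  have h3 : HasStrictFDerivAt (fun x : E => x - ⟪e, x⟫ • e)
      (ContinuousLinearMap.id ℝ E - (innerSL ℝ e).smulRight e) e :=
    (hasStrictFDerivAt_id e).sub ((innerSL ℝ e).hasStrictFDerivAt.smul_const e)
  have h4 := (h1.smul_const e).add (h2.smul h3)
  convert! h4 using 1
  ext y
  simp [he]

lemma exists_nhds_straightenSphere_bilipschitz {e : E} (he : ‖e‖ = 1) {K : ℝ≥0} (hK : 1 < K) :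
    ∃ U ∈ 𝓝 e, LipschitzOnWith K (straightenSphere e) U ∧
      ∀ x ∈ U, ∀ y ∈ U, dist x y ≤ K * dist (straightenSphere e x) (straightenSphere e y) := by
  have hK' : (1 : ℝ) < K := hK
  have hK0 : (0 : ℝ) < K := by linarith
  have hKi : (K : ℝ)⁻¹ < 1 := inv_lt_one_of_one_lt₀ hK'
  let δ : ℝ≥0 := ⟨1 - (K : ℝ)⁻¹, by linarith⟩
  have hδ : 0 < δ := by
    change (0 : ℝ) < 1 - (K : ℝ)⁻¹
    linarith
  obtain ⟨U, hU, h⟩ := (hasStrictFDerivAt_straightenSphere he).approximates_deriv_on_nhds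
    (Or.inr hδ)
  have key : ∀ x ∈ U, ∀ y ∈ U,
      ‖straightenSphere e x - straightenSphere e y - (x - y)‖ ≤ (1 - (K : ℝ)⁻¹) * ‖x - y‖ :=
    fun x hx y hy => h x hx y hy
  refine ⟨U, hU, LipschitzOnWith.of_dist_le_mul fun x hx y hy => ?_, fun x hx y hy => ?_⟩
  · have h1 := key x hx y hy
    have h2 := norm_le_insert' (straightenSphere e x - straightenSphere e y) (x - y)
    rw [dist_eq_norm, dist_eq_norm]
    have h3 : 2 - (K : ℝ)⁻¹ ≤ K := by
      have : (K : ℝ) * (K : ℝ)⁻¹ = 1 := mul_inv_cancel₀ hK0.ne'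
      nlinarith [sq_nonneg ((K : ℝ) - 1), inv_pos.2 hK0]
    nlinarith [norm_nonneg (x - y)]
  · have h1 := key x hx y hy
    have h2 := norm_le_insert (straightenSphere e x - straightenSphere e y) (x - y)
    rw [dist_eq_norm, dist_eq_norm]
    have h3 : (K : ℝ)⁻¹ * ‖x - y‖ ≤ ‖straightenSphere e x - straightenSphere e y‖ := by linarith
    rwa [inv_mul_le_iff₀ hK0] at h3

lemma finrank_orthogonal_singleton {n : ℕ} (hn : finrank ℝ E = n + 1) {e : E} (he : e ≠ 0) :
    finrank ℝ (ℝ ∙ e)ᗮ = n := by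
  have : Fact (finrank ℝ E = n + 1) := ⟨hn⟩
  exact Submodule.finrank_orthogonal_span_singleton he

variable [FiniteDimensional ℝ E] [MeasurableSpace E] [BorelSpace E]

lemma measurePreserving_smul_add_orthogonal {e : E} (he : ‖e‖ = 1) :
    MeasurePreserving (fun p : ℝ × (ℝ ∙ e)ᗮ => p.1 • e + (p.2 : E))
      (volume.prod volume) volume := by
  have h1 : MeasurePreserving (LinearIsometryEquiv.toSpanUnitSingleton (𝕜 := ℝ) e he)
      volume volume := LinearIsometryEquiv.measurePreserving _
  have h2 := h1.prod (MeasurePreserving.id (volume : Measure (ℝ ∙ e)ᗮ))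
  have h3 := (WithLp.volume_preserving_toLp (ℝ ∙ e) (ℝ ∙ e)ᗮ).comp h2
  have h4 := (ℝ ∙ e).orthogonalDecomposition.symm.measurePreserving.comp h3
  convert! h4 using 1

lemma lintegral_eq_lintegral_smul_add_orthogonal {e : E} (he : ‖e‖ = 1) {f : E → ℝ≥0∞}
    (hf : Measurable f) :
    ∫⁻ x, f x = ∫⁻ t : ℝ, ∫⁻ y : (ℝ ∙ e)ᗮ, f (t • e + y) := by
  rw [← (measurePreserving_smul_add_orthogonal he).lintegral_comp hf, lintegral_prod]
  exact (hf.comp (measurePreserving_smul_add_orthogonal he).measurable).aemeasurable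

lemma volume_orthogonal_singleton {n : ℕ} (hn : finrank ℝ E = n + 1) {e : E} (he : e ≠ 0) :
    (volume : Measure (ℝ ∙ e)ᗮ) = μHE[n] := by
  rw [← finrank_orthogonal_singleton hn he, InnerProductSpace.euclideanHausdorffMeasure_eq_volume]

lemma setLIntegral_orthogonal_singleton {n : ℕ} (hn : finrank ℝ E = n + 1) {e : E} (he : e ≠ 0)
    (f : E → ℝ≥0∞) :
    ∫⁻ w in {w : E | ⟪w, e⟫ = 0}, f w ∂μHE[n] = ∫⁻ y : (ℝ ∙ e)ᗮ, f y := by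
  have h : {w : E | ⟪w, e⟫ = 0} = range (Subtype.val : (ℝ ∙ e)ᗮ → E) := by
    ext w
    simp [Submodule.mem_orthogonal_singleton_iff_inner_left]
  rw [h, ← isometry_subtype_coe.map_euclideanHausdorffMeasure, volume_orthogonal_singleton hn he]
  exact MeasurableEmbedding.lintegral_map
    (MeasurableEmbedding.subtype_coe (Submodule.closed_of_finiteDimensional _).measurableSet) _

lemma lintegral_eq_lintegral_toSphere {n : ℕ} (hn : finrank ℝ E = n + 1) {f : E → ℝ≥0∞}
    (hf : Measurable f) :
    ∫⁻ x, f x = ∫⁻ ω : sphere (0 : E) 1, ∫⁻ r in Ioi (0 : ℝ),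
      ENNReal.ofReal (r ^ n) * f (r • (ω : E)) ∂volume ∂(volume : Measure E).toSphere := by
  have : Nontrivial E := nontrivial_of_finrank_pos (R := ℝ) (by lia)
  have hmp := (volume : Measure E).measurePreserving_homeomorphUnitSphereProd
  have hm : MeasurableSet ({0}ᶜ : Set E) := (measurableSet_singleton _).compl
  have hg : Measurable fun p : sphere (0 : E) 1 × Ioi (0 : ℝ) => f (p.2.1 • p.1.1) := by fun_prop
  calc ∫⁻ x, f x = ∫⁻ x in {0}ᶜ, f x := by rw [restrict_compl_singleton]
    _ = ∫⁻ x : ({0}ᶜ : Set E), f x ∂((volume : Measure E).comap (↑)) :=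
        (lintegral_subtype_comap hm f).symm
    _ = ∫⁻ p, f (p.2.1 • p.1.1) ∂((volume : Measure E).toSphere.prod
          (volumeIoiPow (finrank ℝ E - 1))) := by
      rw [← hmp.lintegral_comp hg]
      refine lintegral_congr fun x => ?_
      have : ‖(x : E)‖ ≠ 0 := norm_ne_zero_iff.2 x.2
      simp [smul_smul, this]
    _ = _ := by
      rw [lintegral_prod _ hg.aemeasurable, hn]
      refine lintegral_congr fun ω => ?_
      rw [volumeIoiPow, lintegral_withDensity_eq_lintegral_mul _ (by fun_prop)
        (by fun_prop), ← lintegral_subtype_comap measurableSet_Ioi]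
      simp

lemma lintegral_eq_lintegral_sphericalSquare {m : ℕ} (hn : finrank ℝ E = m + 2) {e : E}
    (he : ‖e‖ = 1) (h : E → ℝ≥0∞) :
    ∫⁻ z, h z = ∫⁻ x in {x | 0 < ⟪e, x⟫},
      ENNReal.ofReal (2 ^ (m + 2) * ⟪e, x⟫ ^ m * ‖x‖ ^ 2) * h (sphericalSquare e x) := by
  have hs : MeasurableSet {x : E | 0 < ⟪e, x⟫} := measurableSet_lt (by fun_prop) (by fun_prop)
  have hnull : volume (sphericalSquare e '' {x | 0 < ⟪e, x⟫})ᶜ = 0 := by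
    refine measure_mono_null (compl_image_sphericalSquare_subset he) (addHaar_submodule _ _ ?_)
    intro htop
    have h1 := finrank_span_singleton (K := ℝ) (v := e) (by rintro rfl; simp at he)
    rw [htop, finrank_top, hn] at h1
    lia
  have hae : sphericalSquare e '' {x | 0 < ⟪e, x⟫} =ᵐ[volume] univ := ae_eq_univ.2 hnull
  rw [← setLIntegral_univ, ← setLIntegral_congr hae,
    lintegral_image_eq_lintegral_abs_det_fderiv_mul volume hs
      (fun x _ => (hasFDerivAt_sphericalSquare e x).hasFDerivWithinAt) (injOn_sphericalSquare he)]
  refine setLIntegral_congr_fun hs fun x hx => ?_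
  have hx : 0 < ⟪e, x⟫ := hx
  rw [det_sphericalSquareDeriv hn he hx.ne', abs_of_pos]
  have : 0 < ‖x‖ := norm_pos_iff.2 (by rintro rfl; simp at hx)
  positivity

lemma lintegral_Ioi_indicator_pow (k : ℕ) :
    ∫⁻ r in Ioi (0 : ℝ), ENNReal.ofReal (r ^ k) * (Iio 1).indicator 1 r =
      ENNReal.ofReal ((k + 1 : ℝ)⁻¹) := by
  have h1 : ∀ r : ℝ, ENNReal.ofReal (r ^ k) * (Iio 1).indicator 1 r =
      (Iio 1).indicator (fun r => ENNReal.ofReal (r ^ k)) r := fun r => by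
    by_cases hr : r ∈ Iio (1 : ℝ) <;> simp [hr]
  simp only [h1]
  rw [setLIntegral_indicator measurableSet_Iio, Iio_inter_Ioi, restrict_congr_set Ioo_ae_eq_Ioc,
    ← ofReal_integral_eq_lintegral_ofReal (intervalIntegral.intervalIntegrable_pow _).1,
    ← intervalIntegral.integral_of_le zero_le_one]
  · simp
  · filter_upwards [ae_restrict_mem measurableSet_Ioc] with y hy
    exact pow_nonneg hy.1.le _

/-- Integration over the unit sphere in the variable `σ = 2 ⟪e, ω⟫ ω - e`. -/
lemma lintegral_toSphere_eq_sphericalSquare {m : ℕ} (hn : finrank ℝ E = m + 2) {e : E}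
    (he : ‖e‖ = 1) {g : E → ℝ≥0∞} (hg : Measurable g) :
    ∫⁻ σ : sphere (0 : E) 1, g σ ∂(volume : Measure E).toSphere =
      2 ^ (m + 1) * ∫⁻ ω : sphere (0 : E) 1,
        {x | 0 < ⟪e, x⟫}.indicator
          (fun x => ENNReal.ofReal (⟪e, x⟫ ^ m) * g ((2 * ⟪e, x⟫) • x - e)) (ω : E)
        ∂(volume : Measure E).toSphere := by
  have hs : MeasurableSet {x : E | 0 < ⟪e, x⟫} := measurableSet_lt (by fun_prop) (by fun_prop)
  set q : E → ℝ≥0∞ := {x | 0 < ⟪e, x⟫}.indicator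
          (fun x => ENNReal.ofReal (⟪e, x⟫ ^ m) * g ((2 * ⟪e, x⟫) • x - e)) with hq
  have hqm : Measurable q := Measurable.indicator (by fun_prop) hs
  set h : E → ℝ≥0∞ := fun z => (Iio (1 : ℝ)).indicator 1 ‖z‖ * g (‖z‖⁻¹ • z) with hh
  have hind : Measurable ((Iio (1 : ℝ)).indicator (1 : ℝ → ℝ≥0∞)) :=
    measurable_one.indicator measurableSet_Iio
  have hhm : Measurable h := by fun_prop
  have hsq : Measurable (sphericalSquare e) := by unfold sphericalSquare; fun_prop
  have hI1 := lintegral_Ioi_indicator_pow (m + 1)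
  have hI2 := lintegral_Ioi_indicator_pow (2 * m + 3)
  have key := lintegral_eq_lintegral_sphericalSquare hn he h
  rw [lintegral_eq_lintegral_toSphere (n := m + 1) hn hhm, ← lintegral_indicator hs,
    lintegral_eq_lintegral_toSphere (n := m + 1) hn (Measurable.indicator (by fun_prop) hs)] at key
  have hL : ∀ ω : sphere (0 : E) 1, ∫⁻ r in Ioi (0 : ℝ),
      ENNReal.ofReal (r ^ (m + 1)) * h (r • (ω : E)) =
      ENNReal.ofReal (((m + 1 : ℕ) + 1 : ℝ)⁻¹) * g ω := by
    intro ω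
    rw [← hI1, ← lintegral_mul_const _ (by fun_prop)]
    refine setLIntegral_congr_fun measurableSet_Ioi fun r (hr : 0 < r) => ?_
    have hω : ‖(ω : E)‖ = 1 := by simp
    simp [hh, norm_smul, hω, abs_of_pos hr, smul_smul, hr.ne', mul_assoc]
  have hR : ∀ ω : sphere (0 : E) 1, ∫⁻ r in Ioi (0 : ℝ),
      ENNReal.ofReal (r ^ (m + 1)) * {x | 0 < ⟪e, x⟫}.indicator (fun x =>
        ENNReal.ofReal (2 ^ (m + 2) * ⟪e, x⟫ ^ m * ‖x‖ ^ 2) * h (sphericalSquare e x))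
        (r • (ω : E)) =
      ENNReal.ofReal (((2 * m + 3 : ℕ) + 1 : ℝ)⁻¹) * (2 ^ (m + 2) * q ω) := by
    intro ω
    rw [← hI2, ← lintegral_mul_const _ (by fun_prop)]
    refine setLIntegral_congr_fun measurableSet_Ioi fun r (hr : 0 < r) => ?_
    have hω : ‖(ω : E)‖ = 1 := by simp
    by_cases hω' : 0 < ⟪e, (ω : E)⟫
    · have hmem : r • (ω : E) ∈ {x : E | 0 < ⟪e, x⟫} := by
        simp only [mem_ofPred_eq, inner_smul_right]; positivity
      have hmem' : (ω : E) ∈ {x : E | 0 < ⟪e, x⟫} := hω'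
      have hsm : (‖sphericalSquare e (r • (ω : E))‖)⁻¹ • sphericalSquare e (r • (ω : E)) =
          (2 * ⟪e, (ω : E)⟫) • (ω : E) - e := by
        rw [norm_sphericalSquare he, sphericalSquare, norm_smul, hω, inner_smul_right,
          smul_sub, smul_smul, smul_smul, smul_smul]
        simp only [Real.norm_eq_abs, abs_of_pos hr]
        congr 1
        · congr 1; field_simp
        · rw [mul_one, inv_mul_cancel₀ (by positivity), one_smul]
      have hind2 : (Iio (1 : ℝ)).indicator (1 : ℝ → ℝ≥0∞) (r ^ 2) = (Iio (1 : ℝ)).indicator 1 r := by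
        simp [indicator, mem_Iio, sq_lt_one_iff₀ hr.le]
      simp only [indicator_of_mem hmem, hq, indicator_of_mem hmem', hh, hsm]
      rw [norm_sphericalSquare he, norm_smul, hω, Real.norm_eq_abs, abs_of_pos hr, mul_one, hind2,
        inner_smul_right]
      have : ENNReal.ofReal (r ^ (m + 1)) *
          ENNReal.ofReal (2 ^ (m + 2) * (r * ⟪e, (ω : E)⟫) ^ m * r ^ 2) =
          ENNReal.ofReal (r ^ (2 * m + 3)) * (2 ^ (m + 2) * ENNReal.ofReal (⟪e, (ω : E)⟫ ^ m)) := by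
        have h2 : (2 : ℝ≥0∞) ^ (m + 2) = ENNReal.ofReal (2 ^ (m + 2)) := by
          rw [ENNReal.ofReal_pow zero_le_two]; simp
        rw [h2, ← ENNReal.ofReal_mul (by positivity), ← ENNReal.ofReal_mul (by positivity),
          ← ENNReal.ofReal_mul (by positivity)]
        congr 1
        ring
      rw [← mul_assoc, this]
      ring
    · have hmem : r • (ω : E) ∉ {x : E | 0 < ⟪e, x⟫} := by
        simp only [mem_ofPred_eq, inner_smul_right, not_lt] at hω' ⊢
        exact mul_nonpos_of_nonneg_of_nonpos hr.le hω'
      have hmem' : (ω : E) ∉ {x : E | 0 < ⟪e, x⟫} := hω'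
      simp only [indicator_of_notMem hmem, hq, indicator_of_notMem hmem', mul_zero]
  simp only [hL, hR] at key
  rw [lintegral_const_mul _ (by fun_prop), lintegral_const_mul _ (by fun_prop),
    lintegral_const_mul _ (by fun_prop)] at key
  have hhalf : ENNReal.ofReal (((2 * m + 3 : ℕ) + 1 : ℝ)⁻¹) * 2 ^ (m + 2) =
      ENNReal.ofReal (((m + 1 : ℕ) + 1 : ℝ)⁻¹) * 2 ^ (m + 1) := by
    have h2 (k : ℕ) : (2 : ℝ≥0∞) ^ k = ENNReal.ofReal (2 ^ k) := by
      rw [ENNReal.ofReal_pow zero_le_two]; simp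
    rw [h2, h2, ← ENNReal.ofReal_mul (by positivity), ← ENNReal.ofReal_mul (by positivity)]
    congr 1
    push_cast
    field_simp
    ring
  rw [← mul_assoc, hhalf, mul_assoc] at key
  refine (ENNReal.mul_right_inj ?_ ENNReal.ofReal_ne_top).1 key
  simp only [ne_eq, ENNReal.ofReal_eq_zero, not_le]
  positivity

lemma volume_norm_mem_and_inv_norm_smul_mem {n : ℕ} (hn : finrank ℝ E = n + 1) {S : Set ℝ}
    (hS : MeasurableSet S) (hS0 : S ⊆ Ioi 0) {A : Set (sphere (0 : E) 1)} (hA : MeasurableSet A) :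
    volume {x : E | ‖x‖ ∈ S ∧ ‖x‖⁻¹ • x ∈ Subtype.val '' A} =
      (∫⁻ r in S, ENNReal.ofReal (r ^ n)) * (volume : Measure E).toSphere A := by
  have hA' : MeasurableSet (Subtype.val '' A : Set E) :=
    (MeasurableEmbedding.subtype_coe isClosed_sphere.measurableSet).measurableSet_image.2 hA
  have hT : MeasurableSet {x : E | ‖x‖ ∈ S ∧ ‖x‖⁻¹ • x ∈ Subtype.val '' A} :=
    (measurable_norm hS).inter ((measurable_norm.inv.smul measurable_id) hA')
  rw [← lintegral_indicator_one hT,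
    lintegral_eq_lintegral_toSphere hn (measurable_one.indicator hT)]
  have key (ω : sphere (0 : E) 1) :
      ∫⁻ r in Ioi (0 : ℝ), ENNReal.ofReal (r ^ n) *
        {x : E | ‖x‖ ∈ S ∧ ‖x‖⁻¹ • x ∈ Subtype.val '' A}.indicator 1 (r • (ω : E)) =
      A.indicator (fun _ => ∫⁻ r in S, ENNReal.ofReal (r ^ n)) ω := by
    have h1 : ∀ r ∈ Ioi (0 : ℝ), ENNReal.ofReal (r ^ n) *
        {x : E | ‖x‖ ∈ S ∧ ‖x‖⁻¹ • x ∈ Subtype.val '' A}.indicator 1 (r • (ω : E)) =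
        S.indicator (fun r => A.indicator (fun _ => ENNReal.ofReal (r ^ n)) ω) r := by
      intro r hr
      have hr0 : (0 : ℝ) < r := hr
      have hnorm : ‖r • (ω : E)‖ = r := by
        rw [norm_smul, norm_eq_of_mem_sphere, mul_one, Real.norm_of_nonneg hr0.le]
      by_cases h : r ∈ S <;> by_cases h' : ω ∈ A <;>
        simp [indicator, hnorm, smul_smul, hr0.ne', h, h']
    rw [setLIntegral_congr_fun measurableSet_Ioi h1, setLIntegral_indicator hS,
      inter_eq_left.2 hS0]
    by_cases h' : ω ∈ A <;> simp [h']
  simp_rw [key]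
  rw [lintegral_indicator hA, setLIntegral_const]

lemma exists_nhds_euclideanHausdorffMeasure_sphere_le {n : ℕ} (hn : finrank ℝ E = n + 1)
    {e : E} (he : ‖e‖ = 1) {K : ℝ≥0} (hK : 1 < K) :
    ∃ V ∈ 𝓝 e, ∀ A : Set (sphere (0 : E) 1), A ⊆ Subtype.val ⁻¹' V → MeasurableSet A →
      μHE[n] A ≤ K ^ (3 * n + 1) * (volume : Measure E).toSphere A ∧
      (volume : Measure E).toSphere A ≤ K ^ (3 * n + 1) * μHE[n] A := by
  have hK' : (1 : ℝ) < K := hK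
  have hK0 : (0 : ℝ) < K := by linarith
  have hKi : (K : ℝ)⁻¹ < 1 := inv_lt_one_of_one_lt₀ hK'
  have he0 : e ≠ 0 := by
    rintro rfl
    simp at he
  obtain ⟨U, hU, hlip, hanti⟩ := exists_nhds_straightenSphere_bilipschitz he hK
  have hcont : Filter.Tendsto (fun p : ℝ × E => p.1 • p.2) (𝓝 1 ×ˢ 𝓝 e) (𝓝 e) := by
    have : Continuous fun p : ℝ × E => p.1 • p.2 := by fun_prop
    simpa [nhds_prod_eq] using this.tendsto (1, e)
  obtain ⟨R, hR, V, hV, hRV⟩ := Filter.mem_prod_iff.1 (hcont hU)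
  obtain ⟨a₀, ha₀, hRa⟩ := exists_Ioc_subset_of_mem_nhds hR ⟨0, zero_lt_one⟩
  set a := max a₀ (K : ℝ)⁻¹ with ha
  have ha1 : a < 1 := max_lt ha₀ hKi
  have haK : (K : ℝ)⁻¹ ≤ a := le_max_right _ _
  have ha0 : 0 < a := (inv_pos.2 hK0).trans_le haK
  refine ⟨V, hV, fun A hAV hA => ?_⟩
  have hU' : ∀ r ∈ Ioc a 1, ∀ x ∈ V, r • x ∈ U := fun r hr x hx =>
    hRV (mk_mem_prod (hRa ⟨(le_max_left _ _).trans_lt hr.1, hr.2⟩) hx)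
  set T : Set E := {x | ‖x‖ ∈ Ioo a 1 ∧ ‖x‖⁻¹ • x ∈ Subtype.val '' A} with hT
  have hAU : Subtype.val '' A ⊆ U := by
    rintro _ ⟨x, hx, rfl⟩
    simpa using hU' 1 ⟨ha1, le_rfl⟩ x (hAV hx)
  have hTU : T ⊆ U := by
    rintro x ⟨h1, ω, hω, h2⟩
    have hx : x = ‖x‖ • (ω : E) := by
      rw [h2, smul_smul, mul_inv_cancel₀ (ha0.trans h1.1).ne', one_smul]
    rw [hx]
    exact hU' _ ⟨h1.1, h1.2.le⟩ _ (hAV hω)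
  have hmem (x : E) : x - ⟪e, x⟫ • e ∈ (ℝ ∙ e)ᗮ := by
    rw [Submodule.mem_orthogonal_singleton_iff_inner_right, inner_sub_right, inner_smul_right,
      real_inner_self_eq_norm_sq, he]
    ring
  set B : Set (ℝ ∙ e)ᗮ := (fun ω : sphere (0 : E) 1 => ⟨_, hmem ω⟩) '' A with hB
  have himA : straightenSphere e '' (Subtype.val '' A) =
      (fun y : (ℝ ∙ e)ᗮ => e + (y : E)) '' B := by
    rw [hB, image_image, image_image]
    exact image_congr fun ω _ => by simp [straightenSphere]
  have himT : straightenSphere e '' T =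
      (fun p : ℝ × (ℝ ∙ e)ᗮ => p.1 • e + (p.2 : E)) '' (Ioo a 1 ×ˢ B) := by
    ext z
    constructor
    · rintro ⟨x, ⟨h1, ω, hω, h2⟩, rfl⟩
      refine ⟨(‖x‖, _), ⟨h1, ω, hω, rfl⟩, ?_⟩
      have h3 : ‖x‖⁻¹ ≠ 0 := inv_ne_zero (ha0.trans h1.1).ne'
      simp [straightenSphere, h2, inner_smul_right, smul_sub, smul_smul]
    · rintro ⟨⟨r, _⟩, ⟨hr, ω, hω, rfl⟩, rfl⟩
      have hr0 : 0 < r := ha0.trans hr.1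
      have hnorm : ‖r • (ω : E)‖ = r := by
        rw [norm_smul, norm_eq_of_mem_sphere, mul_one, Real.norm_of_nonneg hr0.le]
      refine ⟨r • (ω : E), ⟨by rwa [hnorm], ω, hω, ?_⟩, ?_⟩
      · rw [hnorm, smul_smul, inv_mul_cancel₀ hr0.ne', one_smul]
      · simp only [straightenSphere, hnorm, inner_smul_right, smul_sub, smul_smul, ← mul_assoc,
          inv_mul_cancel₀ hr0.ne', one_smul, one_mul]
  have hHA : μHE[n] (Subtype.val '' A : Set E) = μHE[n] A :=
    isometry_subtype_coe.euclideanHausdorffMeasure_image _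
  have hHB : μHE[n] (straightenSphere e '' (Subtype.val '' A)) = volume B := by
    rw [himA, volume_orthogonal_singleton hn he0]
    refine Isometry.euclideanHausdorffMeasure_image ?_ _
    exact Isometry.of_dist_eq fun x y => by simp [Subtype.dist_eq]
  have hVT : μHE[n + 1] (straightenSphere e '' T) = ENNReal.ofReal (1 - a) * volume B := by
    have hP := measurePreserving_smul_add_orthogonal he
    have hinj : Function.Injective (fun p : ℝ × (ℝ ∙ e)ᗮ => p.1 • e + (p.2 : E)) := by
      rintro ⟨r, x⟩ ⟨s, y⟩ h
      have hx := Submodule.mem_orthogonal_singleton_iff_inner_right.1 x.2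
      have hy := Submodule.mem_orthogonal_singleton_iff_inner_right.1 y.2
      have h' : r • e + (x : E) = s • e + (y : E) := h
      have hrs : r = s := by
        have := congrArg (fun z => ⟪e, z⟫) h'
        simpa [inner_add_right, inner_smul_right, hx, hy, he] using this
      subst hrs
      simpa using h'
    have hemb : MeasurableEmbedding (fun p : ℝ × (ℝ ∙ e)ᗮ => p.1 • e + (p.2 : E)) :=
      Continuous.measurableEmbedding (by fun_prop) hinj
    rw [himT, ← hn, InnerProductSpace.euclideanHausdorffMeasure_eq_volume,
      ← hP.measure_preimage_emb hemb, hinj.preimage_image,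
      Measure.prod_prod, Real.volume_Ioo]
  have hTvol : μHE[n + 1] T =
      (∫⁻ r in Ioo a 1, ENNReal.ofReal (r ^ n)) * (volume : Measure E).toSphere A := by
    rw [← hn, InnerProductSpace.euclideanHausdorffMeasure_eq_volume]
    exact volume_norm_mem_and_inv_norm_smul_mem hn measurableSet_Ioo
      (fun r hr => ha0.trans hr.1) hA
  set J := ∫⁻ r in Ioo a 1, ENNReal.ofReal (r ^ n) with hJ
  have hJ1 : J ≤ ENNReal.ofReal (1 - a) := by
    calc J ≤ ∫⁻ r in Ioo a 1, 1 := by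
          refine setLIntegral_mono' measurableSet_Ioo fun r hr => ?_
          exact ENNReal.ofReal_le_one.2 (pow_le_one₀ (ha0.trans hr.1).le hr.2.le)
      _ = _ := by simp
  have hJ2 : ENNReal.ofReal (1 - a) ≤ K ^ n * J := by
    calc ENNReal.ofReal (1 - a) = ∫⁻ r in Ioo a 1, 1 := by simp
      _ ≤ ∫⁻ r in Ioo a 1, (K : ℝ≥0∞) ^ n * ENNReal.ofReal (r ^ n) := by
          refine setLIntegral_mono' measurableSet_Ioo fun r hr => ?_
          have h1 : (1 : ℝ) ≤ K * r := by
            have := mul_le_mul_of_nonneg_left (haK.trans hr.1.le) hK0.le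
            rwa [mul_inv_cancel₀ hK0.ne'] at this
          rw [ENNReal.ofReal_pow (ha0.trans hr.1).le, ← mul_pow, ← ENNReal.ofReal_coe_nnreal,
            ← ENNReal.ofReal_mul hK0.le]
          exact one_le_pow₀ (ENNReal.one_le_ofReal.2 h1)
      _ = _ := lintegral_const_mul' _ _ (by finiteness)
  have hJ'0 : ENNReal.ofReal (1 - a) ≠ 0 := by simpa using ha1
  have hJ0 : J ≠ 0 := by
    intro h
    rw [h, mul_zero, nonpos_iff_eq_zero] at hJ2
    exact hJ'0 hJ2
  have hJt : J ≠ ∞ := (hJ1.trans_lt ENNReal.ofReal_lt_top).ne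
  have hK1 : (1 : ℝ≥0∞) ≤ K := by exact_mod_cast hK.le
  have e1 : μHE[n] A ≤ K ^ n * volume B := by
    rw [← hHA, ← hHB]
    exact euclideanHausdorffMeasure_le_image_of_dist_le
      (fun x hx y hy => hanti x (hAU hx) y (hAU hy)) n
  have e2 : volume B ≤ K ^ n * μHE[n] A := by
    rw [← hHA, ← hHB]
    exact (hlip.mono hAU).euclideanHausdorffMeasure_image_le n
  have e3 : J * (volume : Measure E).toSphere A ≤
      K ^ (n + 1) * (ENNReal.ofReal (1 - a) * volume B) := by
    rw [← hTvol, ← hVT]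
    exact euclideanHausdorffMeasure_le_image_of_dist_le
      (fun x hx y hy => hanti x (hTU hx) y (hTU hy)) (n + 1)
  have e4 : ENNReal.ofReal (1 - a) * volume B ≤
      K ^ (n + 1) * (J * (volume : Measure E).toSphere A) := by
    rw [← hTvol, ← hVT]
    exact (hlip.mono hTU).euclideanHausdorffMeasure_image_le (n + 1)
  constructor
  · have e5 : volume B ≤ K ^ (n + 1) * (volume : Measure E).toSphere A := by
      refine (ENNReal.mul_le_mul_iff_right hJ'0 ENNReal.ofReal_ne_top).1 (e4.trans ?_)
      rw [mul_left_comm]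
      gcongr
    calc μHE[n] A ≤ K ^ n * (K ^ (n + 1) * (volume : Measure E).toSphere A) :=
          e1.trans (by gcongr)
      _ = K ^ (2 * n + 1) * (volume : Measure E).toSphere A := by ring
      _ ≤ _ := by
          gcongr
          norm_num
  · refine (ENNReal.mul_le_mul_iff_right hJ0 hJt).1 ?_
    calc _ ≤ _ := e3
      _ ≤ K ^ (n + 1) * ((K ^ n * J) * (K ^ n * μHE[n] A)) := by gcongr
      _ = _ := by ring

lemma euclideanHausdorffMeasure_sphere_eq_toSphere {n : ℕ} (hn : finrank ℝ E = n + 1) :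
    (μHE[n] : Measure (sphere (0 : E) 1)) = (volume : Measure E).toSphere := by
  have hlim (t : ℝ≥0∞) :
      Filter.Tendsto (fun K : ℝ≥0 => (K : ℝ≥0∞) ^ (3 * n + 1) * t) (𝓝[>] 1) (𝓝 t) := by
    have h1 : Filter.Tendsto (fun K : ℝ≥0 => (K : ℝ≥0∞) ^ (3 * n + 1)) (𝓝[>] 1) (𝓝 1) := by
      have : Continuous fun K : ℝ≥0 => (K : ℝ≥0∞) ^ (3 * n + 1) := by fun_prop
      simpa using (this.tendsto 1).mono_left nhdsWithin_le_nhds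
    simpa using ENNReal.Tendsto.mul_const h1 (Or.inl one_ne_zero)
  have hloc {K : ℝ≥0} (hK : 1 < K) (x : sphere (0 : E) 1) :
      ∃ V ∈ 𝓝 x, ∀ A ⊆ V, MeasurableSet A →
        μHE[n] A ≤ K ^ (3 * n + 1) * (volume : Measure E).toSphere A ∧
        (volume : Measure E).toSphere A ≤ K ^ (3 * n + 1) * μHE[n] A := by
    obtain ⟨V, hV, h⟩ :=
      exists_nhds_euclideanHausdorffMeasure_sphere_le hn (norm_eq_of_mem_sphere x) hK
    exact ⟨_, continuous_subtype_val.continuousAt hV, h⟩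
  have hne : (𝓝[>] (1 : ℝ≥0)).NeBot := nhdsGT_neBot 1
  refine Measure.ext fun A hA => le_antisymm ?_ ?_
  · refine ge_of_tendsto (hlim _) (eventually_mem_nhdsWithin.mono fun K hK => ?_)
    refine measure_le_mul_of_forall_exists_nhds (fun x => ?_) hA
    obtain ⟨V, hV, h⟩ := hloc hK x
    exact ⟨V, hV, fun A hAV hA => (h A hAV hA).1⟩
  · refine ge_of_tendsto (hlim _) (eventually_mem_nhdsWithin.mono fun K hK => ?_)
    refine measure_le_mul_of_forall_exists_nhds (fun x => ?_) hA
    obtain ⟨V, hV, h⟩ := hloc hK x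
    exact ⟨V, hV, fun A hAV hA => (h A hAV hA).2⟩

lemma exists_measurable_eq_setLIntegral_inner_eq_zero {n : ℕ} (hn : finrank ℝ E = n + 1)
    {G : E → E → ℝ≥0∞} (hG : Measurable (Function.uncurry G)) :
    ∃ H : E → ℝ≥0∞, Measurable H ∧
      ∀ k ≠ 0, ∫⁻ w in {w : E | ⟪w, k⟫ = 0}, G k w ∂μHE[n] = H k := by
  have : Nontrivial E := nontrivial_of_finrank_pos (R := ℝ) (by lia)
  obtain ⟨e, he⟩ := exists_norm_eq E zero_le_one
  have he0 : e ≠ 0 := by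
    rintro rfl
    simp at he
  let R : E → E → E := fun k w =>
    -(2 • (⟪e - ‖k‖⁻¹ • k, w⟫ / ‖e - ‖k‖⁻¹ • k‖ ^ 2) • (e - ‖k‖⁻¹ • k) - w)
  have hR : Measurable (Function.uncurry R) := by
    unfold R Function.uncurry
    fun_prop
  refine ⟨fun k => ∫⁻ y : (ℝ ∙ e)ᗮ, G k (R k y), ?_, fun k hk => ?_⟩
  · have : Measurable fun p : E × (ℝ ∙ e)ᗮ => G p.1 (R p.1 p.2) :=
      hG.comp (measurable_fst.prodMk
        (hR.comp (measurable_fst.prodMk (measurable_subtype_coe.comp measurable_snd))))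
    exact this.lintegral_prod_right'
  · have hnorm : ‖e‖ = ‖‖k‖⁻¹ • k‖ := by
      simp [norm_smul, he, hk]
    set ρ := (ℝ ∙ (e - ‖k‖⁻¹ • k))ᗮ.reflection with hρ
    have hρR (w : E) : ρ w = R k w := by
      rw [hρ, Submodule.reflection_orthogonal_apply, Submodule.reflection_singleton_apply]
      rfl
    have hρe : ρ e = ‖k‖⁻¹ • k := Submodule.reflection_sub hnorm
    have hpre : ρ ⁻¹' {w : E | ⟪w, k⟫ = 0} = {w | ⟪w, e⟫ = 0} := by
      ext w
      have h1 : k = ‖k‖ • ρ e := by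
        rw [hρe, smul_smul, mul_inv_cancel₀ (norm_ne_zero_iff.2 hk), one_smul]
      have h2 : ⟪ρ w, k⟫ = ‖k‖ * ⟪w, e⟫ := by
        conv_lhs => rw [h1, inner_smul_right, ρ.inner_map_map]
      simp [h2, hk]
    have hmp : MeasurePreserving ρ (μHE[n] : Measure E) μHE[n] :=
      ρ.toIsometryEquiv.measurePreserving_euclideanHausdorffMeasure n
    rw [← hmp.setLIntegral_comp_preimage_emb ρ.toHomeomorph.measurableEmbedding, hpre,
      setLIntegral_orthogonal_singleton hn he0]
    simp_rw [hρR]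

lemma lintegral_lintegral_toSphere_eq_setLIntegral {m : ℕ} (hm : finrank ℝ E = m + 2)
    {G : E → E → ℝ≥0∞} (hG : Measurable (Function.uncurry G)) :
    ∫⁻ u, ∫⁻ σ : sphere (0 : E) 1, G u σ ∂(volume : Measure E).toSphere =
      2 ^ (m + 1) * ∫⁻ k, ENNReal.ofReal ‖k‖⁻¹ * ∫⁻ w in {w : E | ⟪w, k⟫ = 0},
        G (k + w) ((√(‖k‖ ^ 2 + ‖w‖ ^ 2))⁻¹ • (k - w)) *
          ENNReal.ofReal ((√(‖k‖ ^ 2 + ‖w‖ ^ 2))⁻¹ ^ m) ∂μHE[m + 1] := by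
  have : Nontrivial E := nontrivial_of_finrank_pos (R := ℝ) (by lia)
  set Q : E → E → ℝ≥0∞ := fun k w => G (k + w) ((√(‖k‖ ^ 2 + ‖w‖ ^ 2))⁻¹ • (k - w)) *
    ENNReal.ofReal ((√(‖k‖ ^ 2 + ‖w‖ ^ 2))⁻¹ ^ m) with hQdef
  have hQ : Measurable (Function.uncurry Q) := by
    have h1 : Measurable fun p : E × E => G (p.1 + p.2)
        ((√(‖p.1‖ ^ 2 + ‖p.2‖ ^ 2))⁻¹ • (p.1 - p.2)) :=
      hG.comp (g := Function.uncurry G) (f := fun p : E × E =>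
        (p.1 + p.2, (√(‖p.1‖ ^ 2 + ‖p.2‖ ^ 2))⁻¹ • (p.1 - p.2))) (by fun_prop)
    exact h1.mul (by fun_prop)
  obtain ⟨H, hH, hHQ⟩ := exists_measurable_eq_setLIntegral_inner_eq_zero hm hQ
  set Φ : sphere (0 : E) 1 → E → ℝ≥0∞ := fun ω => {x : E | 0 < ⟪(ω : E), x⟫}.indicator
    fun x => ENNReal.ofReal (⟪(ω : E), x⟫ ^ m) *
      Q (⟪(ω : E), x⟫ • (ω : E)) (x - ⟪(ω : E), x⟫ • (ω : E)) with hΦdef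
  have hΦ : Measurable (Function.uncurry Φ) := by
    have h1 : Measurable fun p : sphere (0 : E) 1 × E => ⟪(p.1 : E), p.2⟫ := by fun_prop
    have h2 : Measurable fun p : sphere (0 : E) 1 × E => ENNReal.ofReal (⟪(p.1 : E), p.2⟫ ^ m) *
        Q (⟪(p.1 : E), p.2⟫ • (p.1 : E)) (p.2 - ⟪(p.1 : E), p.2⟫ • (p.1 : E)) :=
      (h1.pow_const m).ennreal_ofReal.mul (hQ.comp (g := Function.uncurry Q)
        (f := fun p : sphere (0 : E) 1 × E =>
          (⟪(p.1 : E), p.2⟫ • (p.1 : E), p.2 - ⟪(p.1 : E), p.2⟫ • (p.1 : E))) (by fun_prop))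
    exact h2.indicator (measurableSet_lt measurable_const h1)
  have hpolar : ∫⁻ k, ENNReal.ofReal ‖k‖⁻¹ * ∫⁻ w in {w : E | ⟪w, k⟫ = 0}, Q k w ∂μHE[m + 1] =
      ∫⁻ ω : sphere (0 : E) 1, ∫⁻ u, Φ ω u ∂volume ∂(volume : Measure E).toSphere := by
    have h0 : ∫⁻ k, ENNReal.ofReal ‖k‖⁻¹ * ∫⁻ w in {w : E | ⟪w, k⟫ = 0}, Q k w ∂μHE[m + 1] =
        ∫⁻ k, ENNReal.ofReal ‖k‖⁻¹ * H k := by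
      refine lintegral_congr_ae ?_
      filter_upwards [compl_mem_ae_iff.2 (measure_singleton (0 : E))] with k hk
      rw [hHQ k hk]
    rw [h0, lintegral_eq_lintegral_toSphere hm (by fun_prop)]
    refine lintegral_congr fun ω => ?_
    have hω : ‖(ω : E)‖ = 1 := norm_eq_of_mem_sphere ω
    have hω0 : (ω : E) ≠ 0 := ne_zero_of_mem_unit_sphere ω
    have hΦω : Measurable (Φ ω) := hΦ.comp measurable_prodMk_left
    rw [lintegral_eq_lintegral_smul_add_orthogonal hω hΦω,
      ← lintegral_indicator measurableSet_Ioi]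
    refine lintegral_congr fun r => ?_
    have hin (y : (ℝ ∙ (ω : E))ᗮ) : ⟪(ω : E), r • (ω : E) + y⟫ = r := by
      rw [inner_add_right, Submodule.mem_orthogonal_singleton_iff_inner_right.1 y.2,
        inner_smul_right, real_inner_self_eq_norm_sq, hω]
      ring
    by_cases hr : 0 < r
    · have hset : {w : E | ⟪w, r • (ω : E)⟫ = 0} = {w | ⟪w, (ω : E)⟫ = 0} := by
        ext w
        simp [inner_smul_right, hr.ne']
      rw [indicator_of_mem (mem_Ioi.2 hr), ← hHQ _ (smul_ne_zero hr.ne' hω0), hset,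
        setLIntegral_orthogonal_singleton hm hω0, norm_smul, hω, mul_one,
        Real.norm_of_nonneg hr.le, ← mul_assoc, ← ENNReal.ofReal_mul (by positivity), pow_succ,
        mul_assoc, mul_inv_cancel₀ hr.ne', mul_one, ← lintegral_const_mul']
      · refine lintegral_congr fun y => ?_
        simp [Φ, hin, hr]
      · finiteness
    · rw [indicator_of_notMem (by simpa using hr)]
      simp [Φ, hin, hr]
  rw [hpolar, lintegral_lintegral_swap hΦ.aemeasurable,
    ← lintegral_const_mul' _ _ (by finiteness)]
  refine lintegral_congr_ae ?_
  filter_upwards [compl_mem_ae_iff.2 (measure_singleton (0 : E))] with u hu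
  have hu0 : u ≠ 0 := hu
  have hup : 0 < ‖u‖ := norm_pos_iff.2 hu0
  have hun : ‖‖u‖⁻¹ • u‖ = 1 := by simp [norm_smul, hu0]
  have hGu : Measurable (G u) := hG.comp measurable_prodMk_left
  rw [lintegral_toSphere_eq_sphericalSquare hm hun hGu]
  congr 1
  refine lintegral_congr fun ω => ?_
  have hω : ‖(ω : E)‖ = 1 := norm_eq_of_mem_sphere ω
  have hin : ⟪‖u‖⁻¹ • u, (ω : E)⟫ = ‖u‖⁻¹ * ⟪(ω : E), u⟫ := by
    rw [real_inner_smul_left, real_inner_comm]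
  by_cases hpos : 0 < ⟪(ω : E), u⟫
  · have hpos' : 0 < ⟪‖u‖⁻¹ • u, (ω : E)⟫ := by
      rw [hin]
      positivity
    have hsum : ‖⟪(ω : E), u⟫ • (ω : E)‖ ^ 2 + ‖u - ⟪(ω : E), u⟫ • (ω : E)‖ ^ 2 = ‖u‖ ^ 2 := by
      rw [norm_sub_sq_real, norm_smul, hω, inner_smul_right, real_inner_comm u (ω : E),
        Real.norm_eq_abs, mul_one, sq_abs]
      ring
    rw [indicator_of_mem (by exact hpos'), hΦdef]
    simp only
    rw [indicator_of_mem (by exact hpos)]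
    simp only [hQdef, hsum, Real.sqrt_sq hup.le, hin]
    have hvec : (2 * (‖u‖⁻¹ * ⟪(ω : E), u⟫)) • (ω : E) - ‖u‖⁻¹ • u =
        ‖u‖⁻¹ • (⟪(ω : E), u⟫ • (ω : E) - (u - ⟪(ω : E), u⟫ • (ω : E))) := by
      module
    rw [hvec, add_sub_cancel, mul_pow, mul_comm (_ ^ m) (_ ^ m),
      ENNReal.ofReal_mul (by positivity), mul_assoc, mul_comm (G _ _)]
  · have hpos' : ¬ 0 < ⟪‖u‖⁻¹ • u, (ω : E)⟫ := by
      rw [hin, mul_pos_iff_of_pos_left (by positivity)]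
      exact hpos
    rw [indicator_of_notMem (by exact hpos'), hΦdef]
    simp only
    rw [indicator_of_notMem (by exact hpos)]

lemma setLIntegral_unit_sphere_euclideanHausdorffMeasure {n : ℕ} (hn : finrank ℝ E = n + 1)
    (f : E → ℝ≥0∞) :
    ∫⁻ σ in sphere (0 : E) 1, f σ ∂μHE[n] =
      ∫⁻ σ : sphere (0 : E) 1, f σ ∂(volume : Measure E).toSphere := by
  have hemb : MeasurableEmbedding ((↑) : sphere (0 : E) 1 → E) :=
    .subtype_coe isClosed_sphere.measurableSet
  rw [← euclideanHausdorffMeasure_sphere_eq_toSphere hn, ← hemb.lintegral_map,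
    isometry_subtype_coe.map_euclideanHausdorffMeasure, Subtype.range_coe]

end CollisionGeometry

/-- **The change of variables `(v₊, σ) → (v', w)`** (Lemma A.1 of the paper). For a
nonnegative measurable `F`, the double integral of `F(v₊, σ)` over `ℝ^N × S^{N-1}` equals
`2^{N-1}` times the integral over `v' ∈ ℝ^N` of `|v'-v|^{-1}` times the integral over the
hyperplane `{w : w·(v'-v) = 0}` of `F(v'+w, ((v'-v)-w)/r) r^{-(N-2)}`, where
`r = √(|v'-v|² + |w|²)`. Both sides may be infinite. -/
theorem change_of_variables_collision
    (N : ℕ) (hN : 2 ≤ N) (v : EuclideanSpace ℝ (Fin N))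
    (F : EuclideanSpace ℝ (Fin N) → EuclideanSpace ℝ (Fin N) → ℝ≥0∞)
    (hF : Measurable (Function.uncurry F)) :
    (∫⁻ vs, ∫⁻ σ in sphere (0 : EuclideanSpace ℝ (Fin N)) 1, F vs σ ∂(μH[(N : ℝ) - 1])) =
      (2 : ℝ≥0∞) ^ (N - 1) *
        ∫⁻ v', ENNReal.ofReal ‖v' - v‖⁻¹ *
          ∫⁻ w in {w : EuclideanSpace ℝ (Fin N) | ⟪w, v' - v⟫ = 0},
            F (v' + w)
                ((Real.sqrt (‖v' - v‖ ^ 2 + ‖w‖ ^ 2))⁻¹ • ((v' - v) - w)) *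
              ENNReal.ofReal ((Real.sqrt (‖v' - v‖ ^ 2 + ‖w‖ ^ 2)) ^ (-((N : ℝ) - 2)))
            ∂(μH[(N : ℝ) - 1]) := by
  obtain ⟨m, rfl⟩ := Nat.exists_eq_add_of_le' hN
  have hm : Module.finrank ℝ (EuclideanSpace ℝ (Fin (m + 2))) = m + 2 := finrank_euclideanSpace_fin
  obtain ⟨c, hc⟩ := exists_hausdorffMeasure_eq_smul_euclideanHausdorffMeasure
    (EuclideanSpace ℝ (Fin (m + 2))) (m + 1)
  have hd : ((m + 2 : ℕ) : ℝ) - 1 = ((m + 1 : ℕ) : ℝ) := by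
    push_cast
    ring
  have hG : Measurable (Function.uncurry fun u σ => F (v + u) σ) :=
    hF.comp (f := fun p : EuclideanSpace ℝ (Fin (m + 2)) × EuclideanSpace ℝ (Fin (m + 2)) =>
      (v + p.1, p.2)) (by fun_prop)
  have key := lintegral_lintegral_toSphere_eq_setLIntegral hm hG
  rw [hd, hc]
  simp_rw [Measure.restrict_smul, lintegral_smul_measure, ENNReal.smul_def, smul_eq_mul,
    setLIntegral_unit_sphere_euclideanHausdorffMeasure hm, mul_left_comm _ (c : ℝ≥0∞)]
  rw [lintegral_const_mul' _ _ ENNReal.coe_ne_top, lintegral_const_mul' _ _ ENNReal.coe_ne_top,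
    mul_left_comm]
  congr 1
  rw [← lintegral_add_left_eq_self _ v, key, ← lintegral_sub_right_eq_self _ v]
  have hpow (r : ℝ) (hr : 0 ≤ r) : r ^ (-(((m + 2 : ℕ) : ℝ) - 2)) = r⁻¹ ^ m := by
    rw [Real.rpow_neg hr, inv_pow, ← Real.rpow_natCast]
    push_cast
    ring_nf
  simp_rw [hpow _ (Real.sqrt_nonneg _), ← add_assoc, add_sub_cancel]
  rfl
end
end

section
/- Let N ≥ 1 be an integer, ν ∈ (0,2), p ≥ 1, m > 0, μ > 0 and v ∈ ℝ^N. Let A ⊆ S^{N−1} be measurable with surface measure |A| ≥ μ, and let Ξ = {v' ∈ ℝ^N : v' ≠ v and (v'−v)/|v'−v| ∈ A} be the corresponding cone centered at v. Let f : ℝ^N → [0,m] be measurable with 0 < ∫_Ξ f(v')^p dv' < ∞. Then ∫_Ξ (m − f(v')) |v−v'|^{−N−ν} dv' ≥ c m^{1+pν/N} μ^{1+ν/N} (∫_Ξ f(v')^p dv')^{−ν/N}, where c > 0 is a constant depending only on p, ν and N. -/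
open MeasureTheory Metric Set
open scoped ENNReal RealInnerProductSpace

noncomputable section

section ConeVolume

open scoped Pointwise

/-- Normalization is Lipschitz outside the open unit ball. -/
lemma norm_normalize_sub_normalize_le {E : Type*} [NormedAddCommGroup E] [NormedSpace ℝ E]
    {u w : E} (hu : 1 ≤ ‖u‖) (hw : 1 ≤ ‖w‖) :
    ‖‖u‖⁻¹ • u - ‖w‖⁻¹ • w‖ ≤ 2 * ‖u - w‖ := by
  have hu0 : 0 < ‖u‖ := by linarith
  have hw0 : 0 < ‖w‖ := by linarith
  have hinv : ‖u‖⁻¹ ≤ 1 := inv_le_one_of_one_le₀ hu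
  have h1 : ‖u‖⁻¹ • u - ‖w‖⁻¹ • w = ‖u‖⁻¹ • (u - w) + (‖u‖⁻¹ - ‖w‖⁻¹) • w := by
    module
  have h2 : (‖u‖⁻¹ - ‖w‖⁻¹) = ‖u‖⁻¹ * ‖w‖⁻¹ * (‖w‖ - ‖u‖) := by field_simp
  have h3 : ‖(‖u‖⁻¹ - ‖w‖⁻¹) • w‖ = ‖u‖⁻¹ * |‖w‖ - ‖u‖| := by
    rw [norm_smul, h2, Real.norm_eq_abs, abs_mul, abs_of_pos (by positivity)]
    field_simp
  have h4 : |‖w‖ - ‖u‖| ≤ ‖u - w‖ := by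
    rw [norm_sub_rev]; exact abs_norm_sub_norm_le w u
  rw [h1]
  refine (norm_add_le _ _).trans ?_
  rw [h3, norm_smul, norm_inv, norm_norm]
  have := mul_le_mul hinv h4 (abs_nonneg _) zero_le_one
  have := mul_le_mul_of_nonneg_right hinv (norm_nonneg (u - w))
  linarith

lemma EuclideanSpace.norm_toLp_le_card_mul {n : ℕ} (x : Fin (n + 1) → ℝ) {M : ℝ}
    (hx : ∀ j, |x j| ≤ M) : ‖WithLp.toLp 2 x‖ ≤ (n + 1) * M := by
  have hM : 0 ≤ M := (abs_nonneg _).trans (hx 0)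
  rw [EuclideanSpace.norm_eq]
  refine Real.sqrt_le_iff.2 ⟨by positivity, ?_⟩
  have h : ∑ j, ‖x j‖ ^ 2 ≤ ∑ _j : Fin (n + 1), M ^ 2 := by
    gcongr with j
    exact hx j
  refine h.trans ?_
  simp only [Finset.sum_const, Finset.card_univ, Fintype.card_fin, nsmul_eq_mul]
  push_cast
  have : 0 ≤ (n : ℝ) := by positivity
  have : 0 ≤ (n : ℝ) * (n + 1) * M ^ 2 := by positivity
  nlinarith

/-- The affine parametrization of the hyperplane `{x | x i = σ}` of `ℝ^{n+1}`. -/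
def facePoint {n : ℕ} (i : Fin (n + 1)) (σ : ℝ) (y : Fin n → ℝ) :
    EuclideanSpace ℝ (Fin (n + 1)) :=
  WithLp.toLp 2 (i.insertNth (α := fun _ => ℝ) σ y)

/-- The central projection of the hyperplane `{x | x i = σ}` to the unit sphere. -/
def faceProj {n : ℕ} (i : Fin (n + 1)) (σ : ℝ) (y : Fin n → ℝ) :
    EuclideanSpace ℝ (Fin (n + 1)) :=
  ‖facePoint i σ y‖⁻¹ • facePoint i σ y

section Face

variable {n : ℕ} (i : Fin (n + 1))

lemma one_le_norm_facePoint {σ : ℝ} (hσ : |σ| = 1) (y : Fin n → ℝ) : 1 ≤ ‖facePoint i σ y‖ := by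
  have := PiLp.norm_apply_le (facePoint i σ y) i
  simpa [facePoint, hσ] using this

lemma norm_facePoint_sub_le (σ : ℝ) (y z : Fin n → ℝ) :
    ‖facePoint i σ y - facePoint i σ z‖ ≤ (n + 1) * ‖y - z‖ := by
  have h : facePoint i σ y - facePoint i σ z =
      WithLp.toLp 2 (i.insertNth (α := fun _ => ℝ) σ y - i.insertNth (α := fun _ => ℝ) σ z) := rfl
  rw [h]
  refine EuclideanSpace.norm_toLp_le_card_mul _ fun j => ?_
  induction j using Fin.succAboveCases i with
  | x => simp
  | p j => simpa using norm_le_pi_norm (y - z) j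

lemma norm_facePoint_le {σ : ℝ} (hσ : |σ| = 1) {y : Fin n → ℝ} (hy : ‖y‖ ≤ 1) :
    ‖facePoint i σ y‖ ≤ n + 1 := by
  rw [← mul_one ((n : ℝ) + 1)]
  refine EuclideanSpace.norm_toLp_le_card_mul _ fun j => ?_
  induction j using Fin.succAboveCases i with
  | x => simp [hσ]
  | p j => simpa using (norm_le_pi_norm y j).trans hy

lemma lipschitzWith_faceProj {σ : ℝ} (hσ : |σ| = 1) :
    LipschitzWith (2 * (n + 1)) (faceProj i σ) := by
  refine LipschitzWith.of_dist_le_mul fun y z => ?_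
  rw [dist_eq_norm, dist_eq_norm]
  have h1 := norm_normalize_sub_normalize_le (one_le_norm_facePoint i hσ y)
    (one_le_norm_facePoint i hσ z)
  have h2 := norm_facePoint_sub_le i σ y z
  push_cast
  unfold faceProj
  linarith

lemma measurePreserving_facePoint :
    MeasurePreserving (fun q : ℝ × (Fin n → ℝ) => facePoint i q.1 q.2) :=
  (PiLp.volume_preserving_toLp (Fin (n + 1))).comp
    (volume_preserving_piFinSuccAbove (fun _ => ℝ) i).symm

lemma facePoint_mul_smul (t σ : ℝ) (y : Fin n → ℝ) :
    facePoint i (t * σ) (t • y) = t • facePoint i σ y := by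
  ext j
  induction j using Fin.succAboveCases i with
  | x => simp [facePoint]
  | p j => simp [facePoint]

/-- Every unit vector whose `i`-th coordinate is dominant, with sign `σ`, is the central
projection of a point of the face of the cube. -/
lemma exists_faceProj_eq {σ : ℝ} (hσ : σ * σ = 1) {x : EuclideanSpace ℝ (Fin (n + 1))}
    (hx : ‖x‖ = 1) (hdom : ∀ j, |x j| ≤ σ * x i) : ∃ y, ‖y‖ ≤ 1 ∧ faceProj i σ y = x := by
  have ht : 0 < σ * x i := by
    refine lt_of_le_of_ne ((abs_nonneg _).trans (hdom i)) fun h0 => ?_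
    have : x = 0 := by
      ext j
      have := hdom j
      rw [← h0] at this
      simpa using this
    simp [this] at hx
  set t := σ * x i with htdef
  have hxi : x i = t * σ := by rw [htdef]; linear_combination (- x i) * hσ
  refine ⟨fun j => t⁻¹ * x (i.succAbove j), ?_, ?_⟩
  · refine (pi_norm_le_iff_of_nonneg zero_le_one).2 fun j => ?_
    rw [norm_mul, norm_inv, Real.norm_eq_abs, Real.norm_eq_abs, abs_of_pos ht,
      inv_mul_le_iff₀ ht, mul_one]
    exact hdom _
  · have h : x = t • facePoint i σ (fun j => t⁻¹ * x (i.succAbove j)) := by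
      rw [← facePoint_mul_smul]
      ext j
      induction j using Fin.succAboveCases i with
      | x => simp [facePoint, hxi]
      | p j => simp [facePoint, ht.ne']
    set w := facePoint i σ (fun j => t⁻¹ * x (i.succAbove j)) with hw
    have hn : t * ‖w‖ = 1 := by
      rw [← hx, h, norm_smul, Real.norm_eq_abs, abs_of_pos ht]
    rw [faceProj, ← hw, h]
    congr 1
    exact (eq_inv_of_mul_eq_one_left hn).symm

end Face

/-- The truncated cone over `A` with vertex at the origin. -/
def truncatedCone {E : Type*} [NormedAddCommGroup E] [NormedSpace ℝ E] (A : Set E) : Set E :=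
  {x | x ≠ 0 ∧ ‖x‖⁻¹ • x ∈ A} ∩ ball 0 1

lemma measurableSet_truncatedCone {N : ℕ} {A : Set (EuclideanSpace ℝ (Fin N))}
    (hA : MeasurableSet A) : MeasurableSet (truncatedCone A) := by
  have hm : Measurable fun x : EuclideanSpace ℝ (Fin N) => ‖x‖⁻¹ • x := by fun_prop
  exact ((measurableSet_singleton 0).compl.inter (hm hA)).inter measurableSet_ball

lemma volume_face_le_volume_truncatedCone {n : ℕ} (i : Fin (n + 1)) {σ : ℝ}
    (hσ : σ = 1 ∨ σ = -1) {A : Set (EuclideanSpace ℝ (Fin (n + 1)))} (hA : MeasurableSet A) :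
    volume {y : Fin n → ℝ | ‖y‖ ≤ 1 ∧ faceProj i σ y ∈ A} ≤
      ENNReal.ofReal ((2 * (n + 2)) ^ (n + 1)) * volume (truncatedCone A) := by
  set B := {y : Fin n → ℝ | ‖y‖ ≤ 1 ∧ faceProj i σ y ∈ A}
  set h : ℝ := ((n : ℝ) + 2)⁻¹ with hh
  have hpos : 0 < h := by positivity
  have hσ1 : |σ| = 1 := by rcases hσ with rfl | rfl <;> simp
  have hσσ : σ * σ = 1 := by rcases hσ with rfl | rfl <;> simp
  set I : Set ℝ := {s | h / 2 < s * σ ∧ s * σ < h} with hI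
  have hIvol : volume I = ENNReal.ofReal (h / 2) := by
    rcases hσ with rfl | rfl
    · have : I = Ioo (h / 2) h := by ext; simp [hI]
      rw [this, Real.volume_Ioo]; congr 1; ring
    · have : I = Ioo (-h) (-(h / 2)) := by
        ext s; simp only [hI, mem_ofPred_eq, mem_Ioo]; constructor <;> rintro ⟨_, _⟩ <;>
          constructor <;> linarith
      rw [this, Real.volume_Ioo]; congr 1; ring
  have hImeas : MeasurableSet I :=
    measurableSet_Ioo.preimage (measurable_id.mul_const σ)
  have hsub : ∀ s ∈ I, (s * σ) • B ⊆
      Prod.mk s ⁻¹' ((fun q : ℝ × (Fin n → ℝ) => facePoint i q.1 q.2) ⁻¹' truncatedCone A) := by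
    rintro s ⟨hs1, hs2⟩ _ ⟨y, ⟨hy1, hyA⟩, rfl⟩
    have hs : 0 < s * σ := by linarith
    have hsσ : s = (s * σ) * σ := by rw [mul_assoc, hσσ, mul_one]
    have hw := one_le_norm_facePoint i hσ1 y
    have hw' := norm_facePoint_le i hσ1 hy1
    simp only [mem_preimage]
    generalize s * σ = t at *
    subst hsσ
    rw [facePoint_mul_smul]
    have hnorm : ‖t • facePoint i σ y‖ = t * ‖facePoint i σ y‖ := by
      rw [norm_smul, Real.norm_eq_abs, abs_of_pos hs]
    have hw0 : 0 < ‖facePoint i σ y‖ := by linarith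
    refine ⟨⟨?_, ?_⟩, ?_⟩
    · rw [← norm_pos_iff, hnorm]; positivity
    · rw [hnorm, smul_smul, mul_inv, mul_right_comm, inv_mul_cancel₀ hs.ne', one_mul]
      exact hyA
    · rw [mem_ball_zero_iff, hnorm]
      calc t * ‖facePoint i σ y‖ ≤ h * (n + 1) := by gcongr
        _ < h * (n + 2) := by gcongr; norm_num
        _ = 1 := by rw [hh]; field_simp
  have hmeas := measurableSet_truncatedCone hA
  have key : ENNReal.ofReal ((h / 2) ^ (n + 1)) * volume B ≤ volume (truncatedCone A) := by
    rw [← (measurePreserving_facePoint i).measure_preimage hmeas.nullMeasurableSet,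
      Measure.volume_eq_prod, Measure.prod_apply
        ((measurePreserving_facePoint i).measurable hmeas)]
    calc ENNReal.ofReal ((h / 2) ^ (n + 1)) * volume B
        = ∫⁻ _s in I, ENNReal.ofReal ((h / 2) ^ n) * volume B := by
          rw [setLIntegral_const, hIvol, pow_succ, ENNReal.ofReal_mul (by positivity)]
          ring
      _ ≤ ∫⁻ s in I, volume (Prod.mk s ⁻¹'
            ((fun q : ℝ × (Fin n → ℝ) => facePoint i q.1 q.2) ⁻¹' truncatedCone A)) := by
          refine setLIntegral_mono' hImeas fun s hs => ?_
          refine le_trans ?_ (measure_mono (hsub s hs))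
          rw [Measure.addHaar_smul, Module.finrank_fin_fun]
          gcongr
          refine le_trans ?_ (le_abs_self _)
          have := hs.1
          gcongr
      _ ≤ _ := setLIntegral_le_lintegral _ _
  have hone : (2 * ((n : ℝ) + 2)) ^ (n + 1) * (h / 2) ^ (n + 1) = 1 := by
    rw [← mul_pow, hh]; field_simp; simp
  calc volume B = ENNReal.ofReal ((2 * ((n : ℝ) + 2)) ^ (n + 1)) *
        (ENNReal.ofReal ((h / 2) ^ (n + 1)) * volume B) := by
        rw [← mul_assoc, ← ENNReal.ofReal_mul (by positivity), hone]; simp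
    _ ≤ _ := by gcongr

/-- The surface measure of a subset of the unit sphere is controlled by the volume of the
truncated cone over it. -/
lemma exists_hausdorffMeasure_le_mul_volume_truncatedCone (n : ℕ) :
    ∃ C : ℝ, 0 < C ∧ ∀ A : Set (EuclideanSpace ℝ (Fin (n + 1))), A ⊆ sphere 0 1 →
      MeasurableSet A → μH[(n : ℝ)] A ≤ ENNReal.ofReal C * volume (truncatedCone A) := by
  set D : ℝ := (2 * (n + 1)) ^ n * (2 * (n + 2)) ^ (n + 1) with hD
  refine ⟨(n + 1) * (2 * D), by positivity, fun A hAs hA => ?_⟩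
  let P (i : Fin (n + 1)) (σ : ℝ) : Set (EuclideanSpace ℝ (Fin (n + 1))) :=
    faceProj i σ '' {y : Fin n → ℝ | ‖y‖ ≤ 1 ∧ faceProj i σ y ∈ A}
  have hP : ∀ i σ, σ = 1 ∨ σ = -1 →
      μH[(n : ℝ)] (P i σ) ≤ ENNReal.ofReal D * volume (truncatedCone A) := by
    intro i σ hσ
    have hσ1 : |σ| = 1 := by rcases hσ with rfl | rfl <;> simp
    have hvol : (μH[(n : ℝ)] : Measure (Fin n → ℝ)) = volume := by
      simpa using hausdorffMeasure_pi_real (ι := Fin n)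
    refine ((lipschitzWith_faceProj i hσ1).hausdorffMeasure_image_le n.cast_nonneg _).trans ?_
    rw [hvol, hD, ENNReal.ofReal_mul (by positivity), mul_assoc]
    refine mul_le_mul' (le_of_eq ?_) (volume_face_le_volume_truncatedCone i hσ hA)
    rw [ENNReal.rpow_natCast, ENNReal.ofReal_pow (by positivity)]
    congr 1
    rw [ENNReal.ofReal, ENNReal.coe_inj]
    ext
    rw [Real.coe_toNNReal _ (by positivity)]
    push_cast
    rfl
  have hcover : A ⊆ ⋃ i, (P i 1 ∪ P i (-1)) := by
    intro x hx
    have hx1 : ‖x‖ = 1 := by simpa using hAs hx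
    obtain ⟨i, -, hi⟩ := Finset.exists_max_image Finset.univ (fun j => |x j|) Finset.univ_nonempty
    refine mem_iUnion.2 ⟨i, ?_⟩
    rcases abs_cases (x i) with ⟨h, -⟩ | ⟨h, -⟩
    · obtain ⟨y, hy, rfl⟩ := exists_faceProj_eq i (σ := 1) (by norm_num) hx1
        (fun j => by simpa [h] using hi j (Finset.mem_univ j))
      exact Or.inl ⟨y, ⟨hy, hx⟩, rfl⟩
    · obtain ⟨y, hy, rfl⟩ := exists_faceProj_eq i (σ := -1) (by norm_num) hx1
        (fun j => by simpa [h] using hi j (Finset.mem_univ j))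
      exact Or.inr ⟨y, ⟨hy, hx⟩, rfl⟩
  calc μH[(n : ℝ)] A ≤ ∑ i, μH[(n : ℝ)] (P i 1 ∪ P i (-1)) :=
        (measure_mono hcover).trans (measure_iUnion_fintype_le _ _)
    _ ≤ ∑ _i : Fin (n + 1), (2 * (ENNReal.ofReal D * volume (truncatedCone A))) := by
        gcongr with i
        refine (measure_union_le _ _).trans ?_
        rw [two_mul]
        exact add_le_add (hP i 1 (Or.inl rfl)) (hP i (-1) (Or.inr rfl))
    _ = _ := by
        rw [Finset.sum_const, Finset.card_univ, Fintype.card_fin, nsmul_eq_mul,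
          ENNReal.ofReal_mul (p := (n : ℝ) + 1) (by positivity),
          ENNReal.ofReal_mul (p := 2) (by norm_num),
          show (n : ℝ) + 1 = ((n + 1 : ℕ) : ℝ) by push_cast; rfl, ENNReal.ofReal_natCast]
        simp only [ENNReal.ofReal_ofNat, mul_assoc]

/-- The cone over `A` centered at `v`, truncated at radius `R`, contains a translated and dilated
copy of `truncatedCone A`. -/
lemma ofReal_pow_mul_volume_truncatedCone_le {N : ℕ} (A : Set (EuclideanSpace ℝ (Fin N)))
    (v : EuclideanSpace ℝ (Fin N)) {R : ℝ} (hR : 0 < R) :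
    ENNReal.ofReal (R ^ N) * volume (truncatedCone A) ≤
      volume ({x | x ≠ v ∧ ‖x - v‖⁻¹ • (x - v) ∈ A} ∩ ball v R) := by
  have h : ENNReal.ofReal (R ^ N) * volume (truncatedCone A) =
      volume (v +ᵥ R • truncatedCone A) := by
    rw [measure_vadd, Measure.addHaar_smul, finrank_euclideanSpace_fin, abs_of_pos (by positivity)]
  rw [h]
  refine measure_mono ?_
  rintro _ ⟨_, ⟨y, ⟨⟨hy0, hyA⟩, hy1⟩, rfl⟩, rfl⟩
  have hnorm : ‖R • y‖ = R * ‖y‖ := by rw [norm_smul, Real.norm_eq_abs, abs_of_pos hR]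
  simp only [vadd_eq_add]
  refine ⟨⟨?_, ?_⟩, ?_⟩
  · simpa using ⟨hR.ne', hy0⟩
  · rw [add_sub_cancel_left, hnorm, smul_smul, mul_inv, mul_right_comm, inv_mul_cancel₀ hR.ne',
      one_mul]
    exact hyA
  · rw [mem_ball_zero_iff] at hy1
    rw [mem_ball, dist_eq_norm, add_sub_cancel_left, hnorm]
    nlinarith

/-- If `S` has measure at least `2 a`, and the `p`-th moment of `f` on `Ξ ⊇ S` is at most
`a t ^ p`, then `f < t` on a subset of `S` of measure at least `a`. -/
lemma ofReal_le_measure_diff_of_lintegral_rpow_le {α : Type*} [MeasurableSpace α] {μ : Measure α}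
    {S Ξ : Set α} (hS : S ⊆ Ξ) (hΞ : MeasurableSet Ξ) {f : α → ℝ} (hf : Measurable f)
    {p t a : ℝ} (hp : 0 ≤ p) (ht : 0 < t) (ha : 0 ≤ a)
    (hSa : ENNReal.ofReal (2 * a) ≤ μ S)
    (hint : ∫⁻ x in Ξ, ENNReal.ofReal (f x ^ p) ∂μ ≤ ENNReal.ofReal (a * t ^ p)) :
    ENNReal.ofReal a ≤ μ (S \ {x | t ≤ f x}) := by
  have htp : 0 < t ^ p := Real.rpow_pos_of_pos ht p
  have hmarkov : μ ({x | t ≤ f x} ∩ Ξ) ≤ ENNReal.ofReal a := by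
    have h1 := mul_meas_ge_le_lintegral (μ := μ.restrict Ξ) (hf.pow_const p).ennreal_ofReal
      (ENNReal.ofReal (t ^ p))
    have h2 : μ ({x | t ≤ f x} ∩ Ξ) ≤
        μ.restrict Ξ {x | ENNReal.ofReal (t ^ p) ≤ ENNReal.ofReal (f x ^ p)} := by
      rw [Measure.restrict_apply' hΞ]
      refine measure_mono (inter_subset_inter_left _ fun x hx => ?_)
      exact ENNReal.ofReal_le_ofReal (Real.rpow_le_rpow ht.le hx hp)
    have h3 := (mul_le_mul_right h2 (ENNReal.ofReal (t ^ p))).trans (h1.trans hint)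
    rw [mul_comm a, ENNReal.ofReal_mul htp.le] at h3
    exact (ENNReal.mul_le_mul_iff_right (by simpa using htp) ENNReal.ofReal_ne_top).1 h3
  have h : ENNReal.ofReal a + ENNReal.ofReal a ≤
      μ (S \ {x | t ≤ f x}) + ENNReal.ofReal a := by
    rw [← ENNReal.ofReal_add ha ha, ← two_mul]
    calc ENNReal.ofReal (2 * a) ≤ μ S := hSa
      _ ≤ μ ((S \ {x | t ≤ f x}) ∪ ({x | t ≤ f x} ∩ Ξ)) := by
          refine measure_mono fun x hx => ?_
          by_cases h : t ≤ f x
          · exact Or.inr ⟨h, hS hx⟩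
          · exact Or.inl ⟨hx, h⟩
      _ ≤ _ := (measure_union_le _ _).trans (by gcongr)
  exact (ENNReal.add_le_add_iff_right ENNReal.ofReal_ne_top).1 h

end ConeVolume

/-- **Quantified dissipation on a cone at a maximum point** (Lemma 7.2 of the paper). Let
`Ξ` be the cone centered at `v` over a set `A ⊆ S^{N-1}` of measure at least `μ`, and let
`0 ≤ f ≤ m` with `0 < ∫_Ξ f^p < ∞`. Then
`∫_Ξ (m - f(v')) |v-v'|^{-N-ν} dv' ≥ c m^{1+pν/N} μ^{1+ν/N} (∫_Ξ f^p)^{-ν/N}`,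
with `c > 0` depending only on `p`, `ν` and `N`. -/
theorem cone_integral_lower_bound_at_max
    (N : ℕ) (hN : 1 ≤ N) (ν p : ℝ) (hν : ν ∈ Ioo (0:ℝ) 2) (hp : 1 ≤ p) :
    ∃ c : ℝ, 0 < c ∧
      ∀ (m mu : ℝ) (v : EuclideanSpace ℝ (Fin N))
        (A Ξ : Set (EuclideanSpace ℝ (Fin N))) (f : EuclideanSpace ℝ (Fin N) → ℝ),
        0 < m → 0 < mu →
        A ⊆ sphere (0 : EuclideanSpace ℝ (Fin N)) 1 → MeasurableSet A →
        ENNReal.ofReal mu ≤ μH[(N : ℝ) - 1] A →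
        Ξ = {v' : EuclideanSpace ℝ (Fin N) | v' ≠ v ∧ ‖v' - v‖⁻¹ • (v' - v) ∈ A} →
        Measurable f → (∀ x, 0 ≤ f x ∧ f x ≤ m) →
        0 < (∫⁻ v' in Ξ, ENNReal.ofReal (f v' ^ p)) →
        (∫⁻ v' in Ξ, ENNReal.ofReal (f v' ^ p)) < ⊤ →
        ENNReal.ofReal
            (c * m ^ (1 + p * ν / (N : ℝ)) * mu ^ (1 + ν / (N : ℝ)) *
              ((∫⁻ v' in Ξ, ENNReal.ofReal (f v' ^ p)).toReal) ^ (-(ν / (N : ℝ)))) ≤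
          ∫⁻ v' in Ξ, ENNReal.ofReal ((m - f v') * ‖v - v'‖ ^ (-(N : ℝ) - ν)) := by
  obtain ⟨n, rfl⟩ : ∃ n, N = n + 1 := ⟨N - 1, by omega⟩
  obtain ⟨C, hC, hcone⟩ := exists_hausdorffMeasure_le_mul_volume_truncatedCone n
  refine ⟨(C⁻¹ / 4) * (2 ^ (p + 1) * C) ^ (-(ν / ((n + 1 : ℕ) : ℝ))), by positivity, ?_⟩
  intro m mu v A Ξ f hm hmu hAs hA hmuA hΞ hf hfm hI0 hItop
  have hΞm : MeasurableSet Ξ := by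
    have hdir : Measurable fun x : EuclideanSpace ℝ (Fin (n + 1)) => ‖x - v‖⁻¹ • (x - v) := by
      fun_prop
    rw [hΞ]
    exact (measurableSet_singleton v).compl.inter (hdir hA)
  set I := ∫⁻ v' in Ξ, ENNReal.ofReal (f v' ^ p) with hI
  set J := I.toReal with hJdef
  have hJ : 0 < J := ENNReal.toReal_pos hI0.ne' hItop.ne
  have hIJ : I = ENNReal.ofReal J := (ENNReal.ofReal_toReal hItop.ne).symm
  set d : ℝ := ((n + 1 : ℕ) : ℝ) with hd
  have hd0 : 0 < d := by rw [hd]; positivity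
  set Q : ℝ := 2 ^ (p + 1) * C * J * mu⁻¹ * (m ^ p)⁻¹ with hQ
  have hQ0 : 0 < Q := by positivity
  set R : ℝ := Q ^ d⁻¹ with hR
  have hR0 : 0 < R := by positivity
  have hRd : R ^ d = Q := by
    rw [hR, ← Real.rpow_mul hQ0.le, inv_mul_cancel₀ hd0.ne', Real.rpow_one]
  have hRn : R ^ (n + 1) = Q := by rw [← hRd, hd, Real.rpow_natCast]
  set a : ℝ := Q * (C⁻¹ * mu) / 2 with ha
  have ha0 : 0 < a := by positivity
  have hV : ENNReal.ofReal (C⁻¹ * mu) ≤ volume (truncatedCone A) := by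
    have h1 := hcone A hAs hA
    have h2 : d - 1 = n := by rw [hd]; push_cast; ring
    rw [h2] at hmuA
    calc ENNReal.ofReal (C⁻¹ * mu) = ENNReal.ofReal C⁻¹ * ENNReal.ofReal mu :=
          ENNReal.ofReal_mul (by positivity)
      _ ≤ ENNReal.ofReal C⁻¹ * (ENNReal.ofReal C * volume (truncatedCone A)) := by
          gcongr
          exact hmuA.trans h1
      _ = _ := by
          rw [← mul_assoc, ← ENNReal.ofReal_mul (by positivity), inv_mul_cancel₀ hC.ne']
          simp
  have hS : ENNReal.ofReal (2 * a) ≤ volume (Ξ ∩ ball v R) := by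
    have h1 := ofReal_pow_mul_volume_truncatedCone_le A v hR0
    rw [← hΞ, hRn] at h1
    refine le_trans ?_ h1
    rw [show 2 * a = Q * (C⁻¹ * mu) by rw [ha]; ring, ENNReal.ofReal_mul hQ0.le]
    gcongr
  have hmoment : I ≤ ENNReal.ofReal (a * (m / 2) ^ p) := by
    rw [hIJ]
    refine le_of_eq ?_
    congr 1
    rw [ha, hQ, Real.div_rpow hm.le zero_le_two, Real.rpow_add_one two_ne_zero]
    have : m ^ p ≠ 0 := by positivity
    field_simp
  have hdiff := ofReal_le_measure_diff_of_lintegral_rpow_le inter_subset_left hΞm hf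
    (by linarith) (half_pos hm) ha0.le hS hmoment
  have hreal : C⁻¹ / 4 * (2 ^ (p + 1) * C) ^ (-(ν / d)) * m ^ (1 + p * ν / d) *
      mu ^ (1 + ν / d) * J ^ (-(ν / d)) = (m / 2 * R ^ (-d - ν)) * a := by
    have e1 : R ^ (-d - ν) = Q⁻¹ * Q ^ (-(ν / d)) := by
      rw [sub_eq_add_neg, Real.rpow_add hR0, Real.rpow_neg hR0.le, hRd, hR,
        ← Real.rpow_mul hQ0.le]
      congr 2
      field_simp
    have e2 : Q ^ (-(ν / d)) = (2 ^ (p + 1) * C) ^ (-(ν / d)) * J ^ (-(ν / d)) *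
        mu ^ (ν / d) * m ^ (p * ν / d) := by
      rw [hQ, Real.mul_rpow (by positivity) (by positivity),
        Real.mul_rpow (by positivity) (by positivity),
        Real.mul_rpow (by positivity) (by positivity), Real.inv_rpow hmu.le,
        ← Real.rpow_neg hmu.le, neg_neg, Real.inv_rpow (by positivity),
        ← Real.rpow_neg (by positivity), neg_neg, ← Real.rpow_mul hm.le, mul_div_assoc]
    rw [e1, e2, Real.rpow_add hm, Real.rpow_add hmu, Real.rpow_one, Real.rpow_one, ha]
    field_simp
    norm_num
  rw [hreal, ENNReal.ofReal_mul (by positivity)]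
  have hSm : MeasurableSet ((Ξ ∩ ball v R) \ {x | m / 2 ≤ f x}) :=
    (hΞm.inter measurableSet_ball).diff (measurableSet_le measurable_const hf)
  calc ENNReal.ofReal (m / 2 * R ^ (-d - ν)) * ENNReal.ofReal a
      ≤ ENNReal.ofReal (m / 2 * R ^ (-d - ν)) *
          volume ((Ξ ∩ ball v R) \ {x | m / 2 ≤ f x}) := by gcongr
    _ = ∫⁻ _x in (Ξ ∩ ball v R) \ {x | m / 2 ≤ f x}, ENNReal.ofReal (m / 2 * R ^ (-d - ν)) :=
        (setLIntegral_const _ _).symm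
    _ ≤ ∫⁻ x in (Ξ ∩ ball v R) \ {x | m / 2 ≤ f x},
          ENNReal.ofReal ((m - f x) * ‖v - x‖ ^ (-d - ν)) := by
        refine setLIntegral_mono' hSm fun x hx => ENNReal.ofReal_le_ofReal ?_
        obtain ⟨⟨hxΞ, hxR⟩, hxf⟩ := hx
        have hlt : f x < m / 2 := not_le.1 hxf
        have hxv : x ≠ v := by rw [hΞ] at hxΞ; exact hxΞ.1
        have hpos : 0 < ‖v - x‖ := norm_pos_iff.2 (sub_ne_zero.2 hxv.symm)
        have hle : ‖v - x‖ ≤ R := by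
          rw [← dist_eq_norm, dist_comm]; exact (mem_ball.1 hxR).le
        have hexp : -d - ν ≤ 0 := by linarith [hν.1]
        have := Real.rpow_le_rpow_of_nonpos hpos hle hexp
        exact mul_le_mul (by linarith) this (by positivity) (by linarith)
    _ ≤ _ := lintegral_mono_set (sdiff_subset.trans inter_subset_left)
end
end
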